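/- Let Λ = ℤ⁸ with standard basis (e, f, e₁, f₁, e₂, f₂, v₁, v₂) and the symmetric bilinear form B determined by B(e,f) = B(e₁,f₁) = B(e₂,f₂) = 1, B(v₁,v₁) = B(v₂,v₂) = −2, all other pairings of distinct basis vectors equal to 0, and B(e,e) = B(f,f) = B(e₁,e₁) = B(f₁,f₁) = B(e₂,e₂) = B(f₂,f₂) = 0 (the lattice U ⊕ U ⊕ U ⊕ A₁(−1)^{⊕2}), and extend B ℚ-bilinearly to ℚ⁸. Let d ≥ 1 be an integer and h = e + d·f. Then for every x ∈ ℚ⁸ such that B(x,h) = 0 and B(x,z) ∈ ℤ for all z ∈ ℤ⁸ with B(z,h) = 0, there exist q ∈ ℚ and y ∈ ℚ⁸ with B(y,w) ∈ ℤ for all w ∈ ℤ⁸, such that x = q·h + y. -/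

import Mathlib

/-- The bilinear form of the OG6 lattice `U ⊕ U ⊕ U ⊕ A₁(−1)^{⊕2}`, extended
`ℚ`-bilinearly to `ℚ⁸`, with basis `(e, f, e₁, f₁, e₂, f₂, v₁, v₂)`. -/
def BOG6Q (x y : Fin 8 → ℚ) : ℚ :=
  x 0 * y 1 + x 1 * y 0 + x 2 * y 3 + x 3 * y 2 + x 4 * y 5 + x 5 * y 4
    - 2 * x 6 * y 6 - 2 * x 7 * y 7

/-- Coercion `ℤ⁸ → ℚ⁸`. -/
def icast8 (z : Fin 8 → ℤ) : Fin 8 → ℚ := fun i => (z i : ℚ)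

/-- For the OG6 lattice and `h = e + d·f`, the dual of the orthogonal complement of
`h` is contained in `ℚ·h + Λ^∨`. -/
theorem stmt10 (d : ℤ) (hd : 1 ≤ d) :
    ∀ x : Fin 8 → ℚ,
      BOG6Q x (icast8 ![1, d, 0, 0, 0, 0, 0, 0]) = 0 →
      (∀ z : Fin 8 → ℤ, BOG6Q (icast8 z) (icast8 ![1, d, 0, 0, 0, 0, 0, 0]) = 0 →
        ∃ n : ℤ, BOG6Q x (icast8 z) = n) →
      ∃ (q : ℚ) (y : Fin 8 → ℚ),
        (∀ w : Fin 8 → ℤ, ∃ n : ℤ, BOG6Q y (icast8 w) = n) ∧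
        x = q • icast8 ![1, d, 0, 0, 0, 0, 0, 0] + y := by
  intro x _ hx
  refine ⟨x 0, x - x 0 • icast8 ![1, d, 0, 0, 0, 0, 0, 0], ?_, by abel⟩
  intro w
  obtain ⟨n, hn⟩ := hx ![w 0, -d * w 0, w 2, w 3, w 4, w 5, w 6, w 7] (by
    simp [BOG6Q, icast8]; ring)
  refine ⟨n, ?_⟩
  rw [← hn]
  simp [BOG6Q, icast8]
  ring
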